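/- Let m ≥ 1 be an integer. The additive subsemigroup of ℕ² generated by the set {(1,1)} ∪ ((m,m)+ℕ₀²) equals {(k,k) : k ∈ ℕ} ∪ ((m,m)+ℕ₀²). (This is the combination step for the odd-genus case of Theorem 2, with m = ⌊(g+1)/2⌋: the separating semigroup of a non-maximal hyperelliptic curve of odd genus g is ((1,1)ℕ) ∪ ((m,m)+ℕ₀²), generated by the hyperelliptic element (1,1) together with all pairs ≥ (m,m).) -/

import Mathlib

/-- For an integer `m ≥ 1`, the additive subsemigroup of `ℕ²` generated by
`{(1,1)} ∪ ((m,m)+ℕ₀²)` equals `{(k,k) : k ∈ ℕ, k ≥ 1} ∪ ((m,m)+ℕ₀²)`. -/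
theorem closure_diag_union_translate (m : ℕ) (hm : 1 ≤ m) :
    (AddSubsemigroup.closure
        ({((1, 1) : ℕ × ℕ)} ∪ {x : ℕ × ℕ | ∃ e : ℕ × ℕ, x = (m, m) + e}) : Set (ℕ × ℕ)) =
      {x : ℕ × ℕ | ∃ k : ℕ, 1 ≤ k ∧ x = (k, k)} ∪
        {x : ℕ × ℕ | ∃ e : ℕ × ℕ, x = (m, m) + e} := by
  ext x
  constructor
  · intro hx
    induction hx using AddSubsemigroup.closure_induction with
    | mem x hx =>
      rcases hx with rfl | hx
      · exact Or.inl ⟨1, le_rfl, rfl⟩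
      · exact Or.inr hx
    | add x y _ _ hx hy =>
      rcases hx with ⟨k, hk, rfl⟩ | ⟨e, rfl⟩
      · rcases hy with ⟨l, -, rfl⟩ | ⟨f, rfl⟩
        · exact Or.inl ⟨k + l, le_add_right hk, rfl⟩
        · exact Or.inr ⟨(k, k) + f, add_left_comm _ _ _⟩
      · exact Or.inr ⟨e + y, add_assoc _ _ _⟩
  · rintro (⟨k, hk, rfl⟩ | hx)
    · induction k, hk using Nat.le_induction with
      | base => exact AddSubsemigroup.subset_closure (Or.inl rfl)
      | succ k _ ih =>
        exact AddSubsemigroup.add_mem _ ih (AddSubsemigroup.subset_closure (Or.inl rfl))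
    · exact AddSubsemigroup.subset_closure (Or.inr hx)
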